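/- arXiv:2402.09753 — 2 statements merged into one kernel-verified Lean document; each statement's English description precedes it below -/
import Mathlib

section
/- Let sigma be a weight of K and apply S_K and S_- to the pro-p Iwahori invariant functions f_n in ind_K^G sigma. Then for every n >= 1, S_K(f_n) = f_{-n}, and for every n >= 0, S_-(f_{-n}) = f_{n+1}. -/
open scoped Classical

noncomputable section

namespace U21

/-- The arithmetic setting: `E` is the unramified quadratic extension of a non-archimedean
local field `F` of odd residue characteristic `p`, with residue field of `F` of cardinality
`q = p ^ fdeg`.  The field `E` is encoded through its valuation subring `O = o_E`, a
uniformizer `ϖ`, the maximal ideal `mI` (so that `p_E^k` is `ϖ ^ k * O`), and the nontrivial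
`F`-automorphism `conj` of `E` (which induces the `q`-power Frobenius on the residue field
of `E`, of cardinality `q ^ 2`). -/
structure Setting where
  p : ℕ
  q : ℕ
  fdeg : ℕ
  hp : p.Prime
  hodd : p ≠ 2
  hfdeg : 0 < fdeg
  hq : q = p ^ fdeg
  E : Type
  [fieldE : Field E]
  conj : E →+* E
  conj_invol : ∀ x, conj (conj x) = x
  conj_ne : conj ≠ RingHom.id E
  O : Subring E
  val_ring : ∀ x : E, x ≠ 0 → x ∈ O ∨ x⁻¹ ∈ O
  conj_O : ∀ x, x ∈ O → conj x ∈ O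
  ϖ : E
  unif_mem : ϖ ∈ O
  unif_ne : ϖ ≠ 0
  unif_conj : conj ϖ = ϖ
  unif_not_unit : ¬ IsUnit (⟨ϖ, unif_mem⟩ : O)
  disc : ∀ x : E, x ≠ 0 → ∃ (n : ℤ) (u : Oˣ), x = (u : O) * ϖ ^ n
  mI : Ideal O
  hmI : ∀ x : O, x ∈ mI ↔ ∃ y ∈ O, (x : E) = ϖ * y
  [fin_res : Fintype (O ⧸ mI)]
  card_res : Fintype.card (O ⧸ mI) = q ^ 2
  res_frob : ∀ x : O, Ideal.Quotient.mk mI ⟨conj x, conj_O x x.2⟩ = (Ideal.Quotient.mk mI x) ^ q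
  complete : ∀ a : ℕ → E,
    (∀ k : ℕ, ∃ N, ∀ m ≥ N, ∀ n ≥ N, ∃ w ∈ O, a m - a n = ϖ ^ k * w) →
    ∃ L : E, ∀ k : ℕ, ∃ N, ∀ n ≥ N, ∃ w ∈ O, a n - L = ϖ ^ k * w

attribute [instance] Setting.fieldE Setting.fin_res

namespace Setting

variable (S : Setting)

/-- 3×3 matrices over `E`. -/
abbrev M3 := Matrix (Fin 3) (Fin 3) S.E

/-- The antidiagonal matrix `β` of the Hermitian form. -/
def betaM : S.M3 := !![0,0,1;0,1,0;1,0,0]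

/-- The fractional ideal `p_E ^ k ⊆ E` (for `k : ℤ`). -/
def pE (k : ℤ) : Set S.E := {z | ∃ w ∈ S.O, z = S.ϖ ^ k * w}

/-- The unramified unitary group `G = U(2,1)(E/F)`, as a subgroup of `GL₃(E)`:
`g ∈ G` iff `g.transpose * β * conj g = β`. -/
def Gsub : Subgroup (Matrix.GeneralLinearGroup (Fin 3) S.E) where
  carrier := {g | ((g : S.M3)).transpose * S.betaM * ((g : S.M3).map S.conj) = S.betaM}
  one_mem' := by
    simp [Matrix.map_one (⇑S.conj) (map_zero S.conj) (map_one S.conj)]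
  mul_mem' := by
    intro a b ha hb
    simp only [Set.mem_setOf_eq, Units.val_mul, Matrix.transpose_mul, Matrix.map_mul] at ha hb ⊢
    calc ((b : S.M3)).transpose * ((a : S.M3)).transpose * S.betaM * ((a : S.M3).map S.conj * (b : S.M3).map S.conj)
        = ((b : S.M3)).transpose * (((a : S.M3)).transpose * S.betaM * (a : S.M3).map S.conj) * ((b : S.M3).map S.conj) := by
          simp only [mul_assoc]
      _ = S.betaM := by rw [ha]; exact hb
  inv_mem' := by
    intro a ha
    simp only [Set.mem_setOf_eq] at ha ⊢
    have hA : IsUnit ((a : S.M3)) := a.isUnit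
    have hdet : IsUnit ((a : S.M3)).det := (Matrix.isUnit_iff_isUnit_det _).mp hA
    have hAc : IsUnit (((a : S.M3)).map ⇑S.conj) := by
      rw [← RingHom.mapMatrix_apply]; exact hA.map _
    have hdetc : IsUnit ((((a : S.M3)).map ⇑S.conj).det) := (Matrix.isUnit_iff_isUnit_det _).mp hAc
    have hdetT : IsUnit ((((a : S.M3)).transpose).det) := by rw [Matrix.det_transpose]; exact hdet
    have hmapinv : ((a : S.M3)⁻¹).map ⇑S.conj = (((a : S.M3)).map ⇑S.conj)⁻¹ := by
      symm
      apply Matrix.inv_eq_left_inv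
      rw [← Matrix.map_mul, Matrix.nonsing_inv_mul _ hdet,
        Matrix.map_one (⇑S.conj) (map_zero S.conj) (map_one S.conj)]
    rw [Matrix.coe_units_inv, Matrix.transpose_nonsing_inv, hmapinv]
    conv_lhs => rw [← ha]
    calc (((a:S.M3)).transpose)⁻¹ * (((a:S.M3)).transpose * S.betaM * ((a:S.M3)).map ⇑S.conj) * (((a:S.M3)).map ⇑S.conj)⁻¹
        = (((a:S.M3)).transpose)⁻¹ * ((a:S.M3)).transpose * S.betaM *
            (((a:S.M3)).map ⇑S.conj * (((a:S.M3)).map ⇑S.conj)⁻¹) := by simp only [mul_assoc]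
      _ = S.betaM := by
          rw [Matrix.nonsing_inv_mul _ hdetT, Matrix.mul_nonsing_inv _ hdetc, one_mul, mul_one]

/-- The group `G = U(2,1)(E/F)`. -/
abbrev GG := ↥S.Gsub

/-- The matrix of an element of `G`. -/
def mat (g : S.GG) : S.M3 := ((g : Matrix.GeneralLinearGroup (Fin 3) S.E) : S.M3)

/-- The upper unipotent matrix `n(x,y)`. -/
def nM (x y : S.E) : S.M3 := !![1, x, y; 0, 1, -S.conj x; 0, 0, 1]

/-- The lower unipotent matrix `n'(x,y)`. -/
def n'M (x y : S.E) : S.M3 := !![1, 0, 0; x, 1, 0; y, -S.conj x, 1]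

/-- The diagonal matrix `h(x) = diag(x, -x̄x⁻¹, x̄⁻¹)`. -/
def hM (x : S.E) : S.M3 := !![x, 0, 0; 0, -S.conj x * x⁻¹, 0; 0, 0, (S.conj x)⁻¹]

/-- The subgroup `N` of `G` (unipotent radical of the upper triangular Borel), as a set. -/
def Nset : Set S.GG := {g | ∃ x y : S.E, x * S.conj x + y + S.conj y = 0 ∧ S.mat g = S.nM x y}

/-- The subgroup `N_k = {n(x,y) : y ∈ p_E^k}`, as a set. -/
def Nk (k : ℤ) : Set S.GG :=
  {g | ∃ x y : S.E, x * S.conj x + y + S.conj y = 0 ∧ y ∈ S.pE k ∧ S.mat g = S.nM x y}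

/-- The subgroup `N'` of `G`, as a set. -/
def N'set : Set S.GG := {g | ∃ x y : S.E, x * S.conj x + y + S.conj y = 0 ∧ S.mat g = S.n'M x y}

/-- The subgroup `N'_k = {n'(x,y) : y ∈ p_E^k}`, as a set. -/
def N'k (k : ℤ) : Set S.GG :=
  {g | ∃ x y : S.E, x * S.conj x + y + S.conj y = 0 ∧ y ∈ S.pE k ∧ S.mat g = S.n'M x y}

/-- The diagonal subgroup `H` of `G`, as a set. -/
def Hset : Set S.GG := {g | ∃ a b c : S.E, S.mat g = !![a,0,0;0,b,0;0,0,c]}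

/-- The hyperspecial maximal compact subgroup `K₀ = G ∩ GL₃(o_E)`, as a set. -/
def K0set : Set S.GG := {g | ∀ i j, S.mat g i j ∈ S.O}

/-- The special (non-hyperspecial) maximal compact subgroup `K₁`, as a set. -/
def K1set : Set S.GG :=
  {g | S.mat g 0 0 ∈ S.O ∧ S.mat g 0 1 ∈ S.O ∧ S.mat g 0 2 ∈ S.pE (-1) ∧
       S.mat g 1 0 ∈ S.pE 1 ∧ S.mat g 1 1 ∈ S.O ∧ S.mat g 1 2 ∈ S.O ∧
       S.mat g 2 0 ∈ S.pE 1 ∧ S.mat g 2 1 ∈ S.pE 1 ∧ S.mat g 2 2 ∈ S.O}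

/-- The Iwahori subgroup `I_{K₀}` (preimage of the Borel of `Γ_{K₀}`), as a set. -/
def IK0 : Set S.GG :=
  {g | g ∈ S.K0set ∧ S.mat g 1 0 ∈ S.pE 1 ∧ S.mat g 2 0 ∈ S.pE 1 ∧ S.mat g 2 1 ∈ S.pE 1}

/-- The pro-p Iwahori subgroup `I_{1,K₀}`, as a set. -/
def I1K0 : Set S.GG :=
  {g | g ∈ S.IK0 ∧ S.mat g 0 0 - 1 ∈ S.pE 1 ∧ S.mat g 1 1 - 1 ∈ S.pE 1 ∧ S.mat g 2 2 - 1 ∈ S.pE 1}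

/-- The opposite pro-p Iwahori subgroup `I'_{1,K₀}`, as a set. -/
def I1'K0 : Set S.GG :=
  {g | g ∈ S.K0set ∧ S.mat g 0 1 ∈ S.pE 1 ∧ S.mat g 0 2 ∈ S.pE 1 ∧ S.mat g 1 2 ∈ S.pE 1 ∧
       S.mat g 0 0 - 1 ∈ S.pE 1 ∧ S.mat g 1 1 - 1 ∈ S.pE 1 ∧ S.mat g 2 2 - 1 ∈ S.pE 1}

/-- The maximal normal pro-p subgroup `K₀¹` of `K₀` (principal congruence subgroup), as a set. -/
def Kone0 : Set S.GG := {g | ∀ i j, S.mat g i j - (1 : S.M3) i j ∈ S.pE 1}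

/-- The Iwahori subgroup `I_{K₁}`, as a set. -/
def IK1 : Set S.GG := {g | g ∈ S.K1set ∧ S.mat g 2 0 ∈ S.pE 2}

/-- The pro-p Iwahori subgroup `I_{1,K₁}`, as a set. -/
def I1K1 : Set S.GG :=
  {g | g ∈ S.IK1 ∧ S.mat g 0 0 - 1 ∈ S.pE 1 ∧ S.mat g 1 1 - 1 ∈ S.pE 1 ∧ S.mat g 2 2 - 1 ∈ S.pE 1}

/-- The opposite pro-p Iwahori subgroup `I'_{1,K₁}`, as a set. -/
def I1'K1 : Set S.GG :=
  {g | g ∈ S.K1set ∧ S.mat g 0 2 ∈ S.O ∧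
       S.mat g 0 0 - 1 ∈ S.pE 1 ∧ S.mat g 1 1 - 1 ∈ S.pE 1 ∧ S.mat g 2 2 - 1 ∈ S.pE 1}

/-- The maximal normal pro-p subgroup `K₁¹` of `K₁`, as a set. -/
def Kone1 : Set S.GG :=
  {g | g ∈ S.K1set ∧ S.mat g 0 2 ∈ S.O ∧ S.mat g 2 0 ∈ S.pE 2 ∧
       S.mat g 0 0 - 1 ∈ S.pE 1 ∧ S.mat g 1 1 - 1 ∈ S.pE 1 ∧ S.mat g 2 2 - 1 ∈ S.pE 1}

/-- The congruence subgroup of level `n` (used to express smoothness), as a set. -/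
def cong (n : ℕ) : Set S.GG := {g | ∀ i j, S.mat g i j - (1 : S.M3) i j ∈ S.pE n}

def alphaM : S.M3 := !![S.ϖ⁻¹, 0, 0; 0, 1, 0; 0, 0, S.ϖ]

def alphaMinv : S.M3 := !![S.ϖ, 0, 0; 0, 1, 0; 0, 0, S.ϖ⁻¹]

lemma alpha_mul_inv : S.alphaM * S.alphaMinv = 1 := by
  ext i j
  fin_cases i <;> fin_cases j <;>
    simp [alphaM, alphaMinv, Matrix.mul_apply, Fin.sum_univ_three, Matrix.one_apply,
      Matrix.vecHead, Matrix.vecTail, inv_mul_cancel₀ S.unif_ne, mul_inv_cancel₀ S.unif_ne]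

lemma alpha_inv_mul : S.alphaMinv * S.alphaM = 1 := by
  ext i j
  fin_cases i <;> fin_cases j <;>
    simp [alphaM, alphaMinv, Matrix.mul_apply, Fin.sum_univ_three, Matrix.one_apply,
      Matrix.vecHead, Matrix.vecTail, inv_mul_cancel₀ S.unif_ne, mul_inv_cancel₀ S.unif_ne]

def alphaU : Matrix.GeneralLinearGroup (Fin 3) S.E :=
  ⟨S.alphaM, S.alphaMinv, S.alpha_mul_inv, S.alpha_inv_mul⟩

lemma alphaU_mem : S.alphaU ∈ S.Gsub := by
  show ((S.alphaU : S.M3)).transpose * S.betaM * ((S.alphaU : S.M3).map S.conj) = S.betaM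
  have : (S.alphaU : S.M3) = S.alphaM := rfl
  rw [this]
  ext i j
  fin_cases i <;> fin_cases j <;>
    simp [alphaM, betaM, Matrix.mul_apply, Fin.sum_univ_three, Matrix.map_apply,
      Matrix.transpose_apply, Matrix.vecHead, Matrix.vecTail, map_inv₀, S.unif_conj,
      inv_mul_cancel₀ S.unif_ne, mul_inv_cancel₀ S.unif_ne]

/-- The element `α = diag(ϖ⁻¹, 1, ϖ)` of `G`. -/
def alphaE : S.GG := ⟨S.alphaU, S.alphaU_mem⟩

lemma beta_mul_beta : S.betaM * S.betaM = 1 := by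
  ext i j
  fin_cases i <;> fin_cases j <;>
    simp [betaM, Matrix.mul_apply, Fin.sum_univ_three, Matrix.one_apply,
      Matrix.vecHead, Matrix.vecTail]

def betaU : Matrix.GeneralLinearGroup (Fin 3) S.E :=
  ⟨S.betaM, S.betaM, S.beta_mul_beta, S.beta_mul_beta⟩

lemma betaU_mem : S.betaU ∈ S.Gsub := by
  show ((S.betaU : S.M3)).transpose * S.betaM * ((S.betaU : S.M3).map S.conj) = S.betaM
  have : (S.betaU : S.M3) = S.betaM := rfl
  rw [this]
  ext i j
  fin_cases i <;> fin_cases j <;>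
    simp [betaM, Matrix.mul_apply, Fin.sum_univ_three, Matrix.map_apply, Matrix.transpose_apply,
      Matrix.vecHead, Matrix.vecTail]

/-- The element `β` of `G`. -/
def betaE : S.GG := ⟨S.betaU, S.betaU_mem⟩

/-- The element `β' = β * α⁻¹` of `G`. -/
def betaPr : S.GG := S.betaE * S.alphaE⁻¹

/-- A finite set `U` is a set of representatives for the cosets `A/B`. -/
def IsReps (A B : Set S.GG) (U : Finset S.GG) : Prop :=
  (↑U : Set S.GG) ⊆ A ∧ ∀ a ∈ A, ∃! u, u ∈ U ∧ a⁻¹ * u ∈ B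

/-- The residue field `k_E` of `E`. -/
abbrev kE := S.O ⧸ S.mI

/-- The residue map `o_E → k_E`. -/
def resmap : S.O →+* S.kE := Ideal.Quotient.mk S.mI

/-- The group `L_{q³} = {(x,t) ∈ k_E² : x x̄ + t + t̄ = 0}` (where `x̄ = x^q`). -/
def Lbig : Set (S.kE × S.kE) := {z | z.1 * z.1 ^ S.q + z.2 + z.2 ^ S.q = 0}

/-- The group `L_q = {(0,t) ∈ k_E² : t + t̄ = 0}`. -/
def Lsmall : Set (S.kE × S.kE) := {z | z.1 = 0 ∧ z.2 + z.2 ^ S.q = 0}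

/-- `L_{q^t}` for `t ∈ {1,3}`. -/
def Lof (t : ℕ) : Set (S.kE × S.kE) := if t = 3 then S.Lbig else S.Lsmall

end Setting

/-- A choice of one of the two maximal compact open subgroups `K ∈ {K₀, K₁}` of `G`,
together with its maximal normal pro-p subgroup `K¹`, the (pro-p) Iwahori subgroups
`I_K ⊇ I_{1,K}`, the opposite pro-p Iwahori `I'_{1,K}`, the element
`β_K ∈ K ∩ {β, β'}`, and the integers `n_K, m_K, t_K`. -/
structure Chamber (S : Setting) where
  K : Subgroup S.GG
  KoneS : Set S.GG
  IK : Set S.GG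
  I1 : Set S.GG
  I1' : Set S.GG
  βK : S.GG
  nK : ℤ
  mK : ℤ
  tK : ℕ
  cases :
    ((K : Set S.GG) = S.K0set ∧ KoneS = S.Kone0 ∧ IK = S.IK0 ∧ I1 = S.I1K0 ∧ I1' = S.I1'K0 ∧
      βK = S.betaE ∧ nK = 0 ∧ mK = 1 ∧ tK = 3) ∨
    ((K : Set S.GG) = S.K1set ∧ KoneS = S.Kone1 ∧ IK = S.IK1 ∧ I1 = S.I1K1 ∧ I1' = S.I1'K1 ∧
      βK = S.betaPr ∧ nK = -1 ∧ mK = 2 ∧ tK = 1)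

namespace Chamber

variable {S : Setting} (C : Chamber S)

/-- `H₀ = H ∩ I_K`. -/
def H0 : Set S.GG := S.Hset ∩ C.IK

/-- `H₁ = H ∩ I_{1,K}`. -/
def H1 : Set S.GG := S.Hset ∩ C.I1

end Chamber

section RepTheory

variable {S : Setting} (C : Chamber S)
variable (𝔽 : Type) [Field 𝔽]

section Generic

variable {G₀ : Type} [Monoid G₀] {V : Type} [AddCommGroup V] [Module 𝔽 V]

/-- A submodule is invariant under a representation. -/
def Invt (ρ : Representation 𝔽 G₀ V) (Ssub : Submodule 𝔽 V) : Prop :=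
  ∀ g v, v ∈ Ssub → ρ g v ∈ Ssub

/-- The subrepresentation generated by a vector (the span of its orbit). -/
def orbitSpan (ρ : Representation 𝔽 G₀ V) (v : V) : Submodule 𝔽 V :=
  Submodule.span 𝔽 {w | ∃ g, w = ρ g v}

/-- The subrepresentation generated by a vector under a subset `A` of the group. -/
def orbitSpanOn (ρ : Representation 𝔽 G₀ V) (A : Set G₀) (v : V) : Submodule 𝔽 V :=
  Submodule.span 𝔽 {w | ∃ g ∈ A, w = ρ g v}

/-- The quotient of a representation by an invariant submodule `N` is irreducible:
equivalently (by the lattice correspondence), `N ≠ ⊤` and any invariant submodule lying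
between `N` and `⊤` equals `N` or `⊤`. -/
def QuotientIrreducible (ρ : Representation 𝔽 G₀ V) (N : Submodule 𝔽 V) : Prop :=
  N ≠ ⊤ ∧ ∀ Ssub : Submodule 𝔽 V, Invt 𝔽 ρ Ssub → N ≤ Ssub → Ssub = N ∨ Ssub = ⊤

/-- The submodule of vectors invariant under all elements of the subset `A`. -/
def invariantsOn (ρ : Representation 𝔽 G₀ V) (A : Set G₀) : Submodule 𝔽 V where
  carrier := {v | ∀ g ∈ A, ρ g v = v}
  add_mem' := by
    intro a b ha hb g hg
    rw [map_add, ha g hg, hb g hg]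
  zero_mem' := by
    intro g hg
    rw [map_zero]
  smul_mem' := by
    intro c a ha g hg
    rw [map_smul, ha g hg]

/-- The space `Hom_G(ρ₁, ρ₂)` of equivariant linear maps, as a submodule of the linear maps. -/
def EquivHomSub {V₂ : Type} [AddCommGroup V₂] [Module 𝔽 V₂]
    (ρ₁ : Representation 𝔽 G₀ V) (ρ₂ : Representation 𝔽 G₀ V₂) :
    Submodule 𝔽 (V →ₗ[𝔽] V₂) where
  carrier := {φ | ∀ g x, φ (ρ₁ g x) = ρ₂ g (φ x)}
  add_mem' := by
    intro a b ha hb g x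
    simp only [LinearMap.add_apply, ha g x, hb g x, map_add]
  zero_mem' := by
    intro g x
    simp only [LinearMap.zero_apply, map_zero]
  smul_mem' := by
    intro c a ha g x
    simp only [LinearMap.smul_apply, ha g x, map_smul]

end Generic

section Weight

variable (W : Type) [AddCommGroup W] [Module 𝔽 W]
variable (σ : Representation 𝔽 ↥C.K W)

/-- Extension of `σ` to all of `G` (by `1` outside `K`); used to avoid coercion issues. -/
def sigma' : S.GG → Module.End 𝔽 W := fun g => if h : g ∈ C.K then σ ⟨g, h⟩ else 1

/-- `σ` is a weight of `K`: an irreducible smooth representation of `K` over `𝔽`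
factoring through `Γ_K = K / K¹` (automatically finite dimensional). -/
def IsWeight : Prop :=
  Nontrivial W ∧ FiniteDimensional 𝔽 W ∧
  (∀ Ssub : Submodule 𝔽 W, (∀ (k : ↥C.K) (w : W), w ∈ Ssub → σ k w ∈ Ssub) → Ssub = ⊥ ∨ Ssub = ⊤) ∧
  (∀ (g : S.GG) (hg : g ∈ C.K), g ∈ C.KoneS → σ ⟨g, hg⟩ = LinearMap.id)

/-- `σ` is one dimensional of the form `χ ∘ det`. -/
def IsDetWeight : Prop :=
  Module.finrank 𝔽 W = 1 ∧
  ∃ c : S.E → 𝔽, ∀ (g : S.GG) (hg : g ∈ C.K) (w : W), σ ⟨g, hg⟩ w = c ((S.mat g).det) • w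

/-- `j_σ : σ → σ` is the composition of the coinvariant projection `σ → σ_{I'_{1,K}}`
with the inverse of the natural isomorphism `σ^{I_{1,K}} ≅ σ_{I'_{1,K}}`:
it restricts to the identity on `σ^{I_{1,K}}` and kills the augmentation part of
`σ` with respect to `I'_{1,K}`. -/
def IsJ (jσ : W →ₗ[𝔽] W) : Prop :=
  (∀ w : W, (∀ g ∈ C.I1, sigma' C 𝔽 W σ g w = w) → jσ w = w) ∧
  (∀ (w : W) (g : S.GG), g ∈ C.I1' → jσ (sigma' C 𝔽 W σ g w - w) = 0)

/-- The defining conditions of the compact induction `ind_K^G σ`: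
`K`-equivariance on the left and compact support (finitely many cosets `K g`). -/
def IndCarrier : Set (S.GG → W) :=
  {f | (∀ (k : S.GG) (hk : k ∈ C.K) (g : S.GG), f (k * g) = σ ⟨k, hk⟩ (f g)) ∧
       ∃ s : Finset S.GG, ∀ g : S.GG, f g ≠ 0 → ∃ k ∈ C.K, ∃ t ∈ s, g = k * t}

/-- The compact induction `ind_K^G σ`, as a submodule of `G → W`. -/
def IndSub : Submodule 𝔽 (S.GG → W) where
  carrier := IndCarrier C 𝔽 W σ
  add_mem' := by
    rintro f g ⟨hf1, sf, hf2⟩ ⟨hg1, sg, hg2⟩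
    refine ⟨fun k hk x => by simp [hf1 k hk x, hg1 k hk x], sf ∪ sg, fun x hx => ?_⟩
    by_cases h : f x ≠ 0
    · obtain ⟨k, hk, t, ht, rfl⟩ := hf2 x h
      exact ⟨k, hk, t, Finset.mem_union_left _ ht, rfl⟩
    · push_neg at h
      have hgx : g x ≠ 0 := by
        intro h0
        apply hx
        simp [Pi.add_apply, h, h0]
      obtain ⟨k, hk, t, ht, rfl⟩ := hg2 x hgx
      exact ⟨k, hk, t, Finset.mem_union_right _ ht, rfl⟩
  zero_mem' := ⟨fun k hk g => by simp, ∅, fun g hg => absurd rfl hg⟩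
  smul_mem' := by
    rintro c f ⟨hf1, sf, hf2⟩
    refine ⟨fun k hk g => by simp [hf1 k hk g], sf, fun x hx => ?_⟩
    refine hf2 x ?_
    intro h0
    apply hx
    simp [h0]

lemma indAct_mem (g : S.GG) {f : S.GG → W} (hf : f ∈ IndCarrier C 𝔽 W σ) :
    (fun x => f (x * g)) ∈ IndCarrier C 𝔽 W σ := by
  obtain ⟨h1, s, h2⟩ := hf
  refine ⟨fun k hk x => ?_, s.image (· * g⁻¹), ?_⟩
  · show f (k * x * g) = _
    rw [mul_assoc]
    exact h1 k hk (x * g)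
  intro x hx
  obtain ⟨k, hk, t, ht, hxg⟩ := h2 (x * g) hx
  refine ⟨k, hk, t * g⁻¹, Finset.mem_image_of_mem _ ht, ?_⟩
  rw [← mul_assoc, ← hxg, mul_assoc, mul_inv_cancel, mul_one]

/-- The representation of `G` on `ind_K^G σ` by right translation. -/
def indRep : Representation 𝔽 S.GG ↥(IndSub C 𝔽 W σ) where
  toFun g :=
    { toFun := fun f => ⟨fun x => (f : S.GG → W) (x * g), indAct_mem C 𝔽 W σ g f.2⟩
      map_add' := fun f1 f2 => Subtype.ext (funext fun x => rfl)
      map_smul' := fun c f => Subtype.ext (funext fun x => rfl) }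
  map_one' := LinearMap.ext fun f => Subtype.ext (funext fun x => by simp [mul_one])
  map_mul' g h := LinearMap.ext fun f => Subtype.ext (funext fun x => by simp [mul_assoc])

/-- The function `[g, v] ∈ ind_K^G σ`: supported on `K g⁻¹`, with value `v` at `g⁻¹`. -/
def stdFn (g : S.GG) (v : W) : S.GG → W :=
  fun x => if h : x * g ∈ C.K then σ ⟨x * g, h⟩ v else 0

/-- The characterization of the family `f_n` (`n ∈ ℤ`) of `I_{1,K}`-invariant elements of
`ind_K^G σ`: `f_n` is supported on `K α⁻ⁿ I_{1,K}` and has value at `α⁻ⁿ` equal to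
`σ(β_K) v₀` for `n > 0` and `v₀` for `n ≤ 0`, where `v₀` is a fixed nonzero vector of
`σ^{I_{1,K}}`. -/
def IsFFamily (v0 : W) (ff : ℤ → ↥(IndSub C 𝔽 W σ)) : Prop :=
  v0 ≠ 0 ∧ (∀ g ∈ C.I1, sigma' C 𝔽 W σ g v0 = v0) ∧
  (∀ (n : ℤ) (g : S.GG), g ∈ C.I1 → indRep C 𝔽 W σ g (ff n) = ff n) ∧
  (∀ (n : ℤ) (x : S.GG), (ff n : S.GG → W) x ≠ 0 →
    ∃ k ∈ C.K, ∃ i ∈ C.I1, x = k * S.alphaE ^ (-n) * i) ∧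
  (∀ n : ℤ, 0 < n → (ff n : S.GG → W) (S.alphaE ^ (-n)) = sigma' C 𝔽 W σ C.βK v0) ∧
  (∀ n : ℤ, n ≤ 0 → (ff n : S.GG → W) (S.alphaE ^ (-n)) = v0)

/-- The characterization of the Hecke operator `T ∈ End_G(ind_K^G σ)`:
it is `G`-equivariant and satisfies
`T [1, v] = ∑_{u ∈ N_{n_K}/N_{n_K+2}} [u α⁻¹, j_σ σ(u⁻¹) v]
  + ∑_{u ∈ N_{n_K+1}/N_{n_K+2}} [β_K u α⁻¹, j_σ σ(β_K) v]`. -/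
def IsHeckeT (jσ : W →ₗ[𝔽] W) (T : Module.End 𝔽 ↥(IndSub C 𝔽 W σ)) : Prop :=
  (∀ (g : S.GG) (x : ↥(IndSub C 𝔽 W σ)),
    T (indRep C 𝔽 W σ g x) = indRep C 𝔽 W σ g (T x)) ∧
  (∀ (v : W) (x : ↥(IndSub C 𝔽 W σ)), (x : S.GG → W) = stdFn C 𝔽 W σ 1 v →
    ∀ (U2 U1 : Finset S.GG),
      S.IsReps (S.Nk C.nK) (S.Nk (C.nK + 2)) U2 →
      S.IsReps (S.Nk (C.nK + 1)) (S.Nk (C.nK + 2)) U1 →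
      ((T x : S.GG → W)) =
        (∑ u ∈ U2, stdFn C 𝔽 W σ (u * S.alphaE⁻¹) (jσ (sigma' C 𝔽 W σ u⁻¹ v))) +
        ∑ u ∈ U1, stdFn C 𝔽 W σ (C.βK * u * S.alphaE⁻¹) (jσ (sigma' C 𝔽 W σ C.βK v)))

/-- The eigencharacter `χ_σ` of `H₀/H₁` afforded by the (one-dimensional) space
`σ^{I_{1,K}}` with chosen basis vector `v₀`. -/
def IsChi (v0 : W) (χ : S.GG → 𝔽) : Prop :=
  (∀ h ∈ C.H0, sigma' C 𝔽 W σ h v0 = χ h • v0)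

/-- Right translation on functions `K → 𝔽` (the action on a (finite) principal series). -/
def PSact (k : ↥C.K) (f : ↥C.K → 𝔽) : ↥C.K → 𝔽 := fun x => f (x * k)

/-- The (inflation to `K` of the) finite principal series `Ind_𝔹^{Γ_K} χ`:
functions on `K`, invariant under right translation by `K¹`, left `I_{1,K}`-invariant and
left `(H₀, χ)`-equivariant. -/
def PSchiSub (χ : S.GG → 𝔽) : Submodule 𝔽 (↥C.K → 𝔽) where
  carrier := {f | (∀ b : ↥C.K, (b : S.GG) ∈ C.I1 → ∀ x, f (b * x) = f x) ∧
                  (∀ h : ↥C.K, (h : S.GG) ∈ C.H0 → ∀ x, f (h * x) = χ (h : S.GG) * f x) ∧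
                  (∀ z : ↥C.K, (z : S.GG) ∈ C.KoneS → ∀ x, f (x * z) = f x)}
  add_mem' := by
    rintro f g ⟨hf1, hf2, hf3⟩ ⟨hg1, hg2, hg3⟩
    exact ⟨fun b hb x => by simp [hf1 b hb x, hg1 b hb x],
           fun h hh x => by simp [hf2 h hh x, hg2 h hh x, mul_add],
           fun z hz x => by simp [hf3 z hz x, hg3 z hz x]⟩
  zero_mem' := ⟨fun b hb x => rfl, fun h hh x => by simp, fun z hz x => rfl⟩
  smul_mem' := by
    rintro c f ⟨hf1, hf2, hf3⟩
    refine ⟨fun b hb x => by simp [hf1 b hb x], fun h hh x => ?_, fun z hz x => by simp [hf3 z hz x]⟩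
    simp only [Pi.smul_apply, hf2 h hh x, smul_eq_mul]
    ring

/-- The principal series `Ind_𝔹^{Γ_K} 1` for the trivial character. -/
def PS1sub : Submodule 𝔽 (↥C.K → 𝔽) := PSchiSub C 𝔽 (fun _ => 1)

/-- `σ_{st}` is the Steinberg weight `st = (Ind_𝔹^{Γ_K} 1)/1`: there is a surjective
`K`-equivariant linear map from `Ind_𝔹^{Γ_K} 1` to it whose kernel is exactly the
constant functions. -/
def IsSteinberg {Wst : Type} [AddCommGroup Wst] [Module 𝔽 Wst]
    (σst : Representation 𝔽 ↥C.K Wst) : Prop :=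
  ∃ φ : ↥(PS1sub C 𝔽) →ₗ[𝔽] Wst, Function.Surjective φ ∧
    (∀ f : ↥(PS1sub C 𝔽), φ f = 0 ↔ ∃ c : 𝔽, (f : ↥C.K → 𝔽) = fun _ => c) ∧
    (∀ (k : ↥C.K) (f f' : ↥(PS1sub C 𝔽)),
      (f' : ↥C.K → 𝔽) = PSact C 𝔽 k (f : ↥C.K → 𝔽) → φ f' = σst k (φ f))

/-- `σ` is isomorphic to a twist of the Steinberg weight by a character. -/
def IsTwistSteinberg : Prop :=
  ∃ (c : ↥C.K →* 𝔽ˣ) (φ : ↥(PS1sub C 𝔽) →ₗ[𝔽] W), Function.Surjective φ ∧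
    (∀ f : ↥(PS1sub C 𝔽), φ f = 0 ↔ ∃ cc : 𝔽, (f : ↥C.K → 𝔽) = fun _ => cc) ∧
    (∀ (k : ↥C.K) (f f' : ↥(PS1sub C 𝔽)),
      (f' : ↥C.K → 𝔽) = PSact C 𝔽 k (f : ↥C.K → 𝔽) →
        φ f' = (c k : 𝔽) • σ k (φ f))


/-- The `K`-subrepresentation of the quotient `(ind_K^G σ) / (range T)` generated by the
image of a vector `v`. -/
def genQuot (T : Module.End 𝔽 ↥(IndSub C 𝔽 W σ)) (v : ↥(IndSub C 𝔽 W σ)) :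
    Submodule 𝔽 (↥(IndSub C 𝔽 W σ) ⧸ LinearMap.range T) :=
  Submodule.span 𝔽 {w | ∃ k ∈ C.K, w = Submodule.Quotient.mk (indRep C 𝔽 W σ k v)}

end Weight

/-- Smoothness of a representation of `G`: every vector is fixed by some congruence
subgroup (equivalently, has open stabilizer). -/
def SmoothRep {V : Type} [AddCommGroup V] [Module 𝔽 V] (ρ : Representation 𝔽 S.GG V) : Prop :=
  ∀ v : V, ∃ n : ℕ, ∀ g ∈ S.cong n, ρ g v = v

end RepTheory

end U21

namespace U21

namespace Setting

variable (S : Setting)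

section Valuation

variable {S}

lemma zero_mem_pE (k : ℤ) : (0 : S.E) ∈ S.pE k := ⟨0, S.O.zero_mem, by simp⟩

lemma add_mem_pE {k : ℤ} {x y : S.E} (hx : x ∈ S.pE k) (hy : y ∈ S.pE k) : x + y ∈ S.pE k := by
  obtain ⟨a, ha, rfl⟩ := hx
  obtain ⟨b, hb, rfl⟩ := hy
  exact ⟨a + b, S.O.add_mem ha hb, by ring⟩

lemma neg_mem_pE {k : ℤ} {x : S.E} (hx : x ∈ S.pE k) : -x ∈ S.pE k := by
  obtain ⟨a, ha, rfl⟩ := hx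
  exact ⟨-a, S.O.neg_mem ha, by ring⟩

lemma mul_mem_pE {k l : ℤ} {x y : S.E} (hx : x ∈ S.pE k) (hy : y ∈ S.pE l) :
    x * y ∈ S.pE (k + l) := by
  obtain ⟨a, ha, rfl⟩ := hx
  obtain ⟨b, hb, rfl⟩ := hy
  exact ⟨a * b, S.O.mul_mem ha hb, by rw [zpow_add₀ S.unif_ne]; ring⟩

lemma conj_mem_pE {k : ℤ} {x : S.E} (hx : x ∈ S.pE k) : S.conj x ∈ S.pE k := by
  obtain ⟨a, ha, rfl⟩ := hx
  exact ⟨S.conj a, S.conj_O a ha, by rw [map_mul, map_zpow₀, S.unif_conj]⟩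

lemma mem_pE_zero {x : S.E} : x ∈ S.pE 0 ↔ x ∈ S.O := by
  simp [pE]

lemma zpow_mem_pE (k : ℤ) : S.ϖ ^ k ∈ S.pE k := ⟨1, S.O.one_mem, by simp⟩

lemma pE_mono {k l : ℤ} (h : k ≤ l) {x : S.E} (hx : x ∈ S.pE l) : x ∈ S.pE k := by
  obtain ⟨a, ha, rfl⟩ := hx
  obtain ⟨d, rfl⟩ := Int.le.dest h
  refine ⟨S.ϖ ^ d * a, S.O.mul_mem (S.O.pow_mem S.unif_mem d) ha, ?_⟩
  rw [zpow_add₀ S.unif_ne, zpow_natCast, mul_assoc]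

lemma zpow_mul_mem_pE {k m : ℤ} {x : S.E} : S.ϖ ^ m * x ∈ S.pE k ↔ x ∈ S.pE (k - m) := by
  constructor
  · intro h
    have := mul_mem_pE (zpow_mem_pE (-m)) h
    rwa [← mul_assoc, ← zpow_add₀ S.unif_ne, neg_add_cancel, zpow_zero, one_mul,
      neg_add_eq_sub] at this
  · intro h
    simpa using mul_mem_pE (zpow_mem_pE m) h

lemma one_notMem_pE_one : (1 : S.E) ∉ S.pE 1 := by
  rintro ⟨w, hw, h⟩
  rw [zpow_one] at h
  exact S.unif_not_unit (IsUnit.of_mul_eq_one ⟨w, hw⟩ (Subtype.ext h.symm))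

lemma ne_zero_of_sub_one_mem {c : S.E} (hc : c - 1 ∈ S.pE 1) : c ≠ 0 := by
  rintro rfl
  exact one_notMem_pE_one (by simpa using neg_mem_pE hc)

lemma inv_mem_of_sub_one_mem {c : S.E} (hc : c - 1 ∈ S.pE 1) : c⁻¹ ∈ S.pE 0 := by
  obtain ⟨n, u, hu⟩ := S.disc c (ne_zero_of_sub_one_mem hc)
  rcases le_or_gt n 0 with hn | hn
  · have hv : (((u⁻¹ : S.Oˣ) : S.O) : S.E) * ((u : S.O) : S.E) = 1 := by
      rw [← Subring.coe_mul, ← Units.val_mul]; simp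
    have hinv : c⁻¹ = S.ϖ ^ (-n) * (((u⁻¹ : S.Oˣ) : S.O) : S.E) := by
      rw [hu, mul_inv, zpow_neg, mul_comm, eq_inv_of_mul_eq_one_left hv]
    exact pE_mono (k := 0) (l := -n) (by omega) ⟨_, ((u⁻¹ : S.Oˣ) : S.O).2, hinv⟩
  · have hc1 : c ∈ S.pE 1 := pE_mono (k := 1) (l := n) (by omega)
      ⟨_, ((u : S.Oˣ) : S.O).2, by rw [hu, mul_comm]⟩
    exact absurd (by simpa using add_mem_pE hc1 (neg_mem_pE hc)) (one_notMem_pE_one (S := S))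

lemma mem_pE_of_norm_mem {k j : ℤ} {x : S.E} (hx : x * S.conj x ∈ S.pE k) (hj : 2 * j - 1 ≤ k) :
    x ∈ S.pE j := by
  by_cases h0 : x = 0
  · rw [h0]; exact zero_mem_pE j
  obtain ⟨n, u, hu⟩ := S.disc x h0
  rcases le_or_gt j n with hn | hn
  · exact pE_mono hn ⟨_, ((u : S.Oˣ) : S.O).2, by rw [hu, mul_comm]⟩
  · exfalso
    have hv : (((u⁻¹ : S.Oˣ) : S.O) : S.E) * ((u : S.O) : S.E) = 1 := by
      rw [← Subring.coe_mul, ← Units.val_mul]; simp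
    set v : S.E := (((u⁻¹ : S.Oˣ) : S.O) : S.E)
    have hvO : v ∈ S.pE 0 := mem_pE_zero.2 ((u⁻¹ : S.Oˣ) : S.O).2
    have hvc : S.conj v * S.conj ((u : S.O) : S.E) = 1 := by rw [← map_mul, hv, map_one]
    have h1 := mul_mem_pE (zpow_mem_pE (-(2 * n))) (mul_mem_pE (mul_mem_pE hvO (conj_mem_pE hvO)) hx)
    have h2 : S.ϖ ^ (-(2 * n)) * (v * S.conj v * (x * S.conj x)) = 1 := by
      rw [hu, map_mul, map_zpow₀, S.unif_conj]
      have hw : S.ϖ ^ (-(2 * n)) * (S.ϖ ^ n * S.ϖ ^ n) = 1 := by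
        rw [← zpow_add₀ S.unif_ne, ← zpow_add₀ S.unif_ne, show -(2 * n) + (n + n) = 0 by ring,
          zpow_zero]
      linear_combination (S.ϖ ^ (-(2 * n)) * (S.ϖ ^ n * S.ϖ ^ n)) *
        (S.conj v * S.conj ((u : S.O) : S.E)) * hv +
        (S.ϖ ^ (-(2 * n)) * (S.ϖ ^ n * S.ϖ ^ n)) * hvc + hw
    rw [h2] at h1
    exact one_notMem_pE_one (pE_mono (by omega) h1)

lemma mul_conj_mem_pE {k : ℤ} {x x' : S.E} (hx : x * S.conj x ∈ S.pE k)
    (hx' : x' * S.conj x' ∈ S.pE k) : x * S.conj x' ∈ S.pE k := by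
  have h : 2 * ((k + 1) / 2) - 1 ≤ k := by omega
  exact pE_mono (by omega)
    (mul_mem_pE (mem_pE_of_norm_mem hx h) (conj_mem_pE (mem_pE_of_norm_mem hx' h)))

lemma norm_mem_pE {k : ℤ} {x y : S.E} (h : x * S.conj x + y + S.conj y = 0) (hy : y ∈ S.pE k) :
    x * S.conj x ∈ S.pE k := by
  have : x * S.conj x = -(y + S.conj y) := by linear_combination h
  rw [this]
  exact neg_mem_pE (add_mem_pE hy (conj_mem_pE hy))

end Valuation

section Matrices

variable {S}

lemma mat_injective : Function.Injective S.mat := fun _ _ h => Subtype.ext (Units.ext h)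

lemma mat_one : S.mat 1 = 1 := rfl

lemma mat_mul (g h : S.GG) : S.mat (g * h) = S.mat g * S.mat h := rfl

lemma mat_betaE : S.mat S.betaE = S.betaM := rfl

lemma mat_alphaE_zpow (n : ℤ) :
    S.mat (S.alphaE ^ n) = !![S.ϖ ^ (-n), 0, 0; 0, 1, 0; 0, 0, S.ϖ ^ n] := by
  have hα : S.mat S.alphaE = S.alphaM := rfl
  have hα' : S.mat S.alphaE⁻¹ = S.alphaMinv := rfl
  induction n with
  | zero =>
    rw [zpow_zero, mat_one]
    ext i j
    fin_cases i <;> fin_cases j <;> simp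
  | succ n ih =>
    rw [zpow_add_one, mat_mul, ih, hα]
    ext i j
    fin_cases i <;> fin_cases j <;>
      simp [alphaM, Matrix.mul_apply, Fin.sum_univ_three, zpow_add₀ S.unif_ne, mul_comm]
  | pred n ih =>
    rw [zpow_sub_one, mat_mul, ih, hα']
    ext i j
    fin_cases i <;> fin_cases j <;>
      simp [alphaMinv, Matrix.mul_apply, Fin.sum_univ_three, zpow_sub₀ S.unif_ne,
        zpow_add₀ S.unif_ne, div_eq_mul_inv, mul_comm]

/-- The weight of the `i`-th diagonal entry of `α`. -/
def wt : Fin 3 → ℤ := ![-1, 0, 1]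

lemma mat_alphaE_conj (n : ℤ) (g : S.GG) (i j : Fin 3) :
    S.mat (S.alphaE ^ n * g * S.alphaE ^ (-n)) i j = S.ϖ ^ (n * (wt i - wt j)) * S.mat g i j := by
  have hd : ∀ m : ℤ, S.mat (S.alphaE ^ m) = Matrix.diagonal fun i => S.ϖ ^ (m * wt i) := by
    intro m
    rw [mat_alphaE_zpow]
    ext i j
    fin_cases i <;> fin_cases j <;> simp [wt]
  rw [mat_mul, mat_mul, hd, hd, Matrix.mul_diagonal, Matrix.diagonal_mul,
    show n * (wt i - wt j) = n * wt i + -n * wt j by ring, zpow_add₀ S.unif_ne]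
  ring

lemma mat_betaE_conj (g : S.GG) (i j : Fin 3) :
    S.mat (S.betaE * g * S.betaE) i j = S.mat g i.rev j.rev := by
  rw [mat_mul, mat_mul, mat_betaE]
  simp only [betaM, Matrix.mul_apply, Fin.sum_univ_three]
  fin_cases i <;> fin_cases j <;> simp [Fin.rev]

lemma betaE_mul_self : S.betaE * S.betaE = 1 := mat_injective S.beta_mul_beta

lemma betaE_inv : S.betaE⁻¹ = S.betaE := inv_eq_of_mul_eq_one_left betaE_mul_self

lemma alphaE_zpow_mul_betaE (n : ℤ) : S.alphaE ^ n * S.betaE = S.betaE * S.alphaE ^ (-n) := by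
  apply mat_injective
  rw [mat_mul, mat_mul, mat_alphaE_zpow, mat_alphaE_zpow, mat_betaE]
  ext i j
  fin_cases i <;> fin_cases j <;> simp [betaM, Matrix.mul_apply, Fin.sum_univ_three]

lemma row_form (g : S.GG) (i j : Fin 3) :
    S.mat g i 0 * S.conj (S.mat g j 2) + S.mat g i 1 * S.conj (S.mat g j 1) +
      S.mat g i 2 * S.conj (S.mat g j 0) = S.betaM i j := by
  have h : (S.mat g).transpose * S.betaM * (S.mat g).map S.conj = S.betaM := g.2
  have h1 : (S.betaM * (S.mat g).transpose * S.betaM) * (S.mat g).map S.conj = 1 := by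
    calc _ = S.betaM * ((S.mat g).transpose * S.betaM * (S.mat g).map S.conj) := by
          simp only [mul_assoc]
      _ = 1 := by rw [h, S.beta_mul_beta]
  have h2 : (S.mat g).map S.conj * (S.betaM * (S.mat g).transpose * S.betaM) = 1 :=
    mul_eq_one_comm.1 h1
  have h3 : (S.mat g).map S.conj * S.betaM * (S.mat g).transpose = S.betaM := by
    calc _ = (S.mat g).map S.conj * S.betaM * (S.mat g).transpose * (S.betaM * S.betaM) := by
          rw [S.beta_mul_beta, mul_one]
      _ = ((S.mat g).map S.conj * (S.betaM * (S.mat g).transpose * S.betaM)) * S.betaM := by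
          simp only [mul_assoc]
      _ = S.betaM := by rw [h2, one_mul]
  have h4 := congrFun (congrFun h3 j) i
  simp only [Matrix.mul_apply, Fin.sum_univ_three, Matrix.map_apply, Matrix.transpose_apply,
    betaM] at h4 ⊢
  fin_cases i <;> fin_cases j <;> simp at h4 ⊢ <;> linear_combination h4

lemma exists_mat_eq_nM {x y : S.E} (h : x * S.conj x + y + S.conj y = 0) :
    ∃ g : S.GG, S.mat g = S.nM x y := by
  have h1 : S.nM x y * S.nM (-x) (S.conj y) = 1 := by
    ext i j
    fin_cases i <;> fin_cases j <;>
      simp [nM, Matrix.mul_apply, Fin.sum_univ_three]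
    linear_combination h
  refine ⟨⟨⟨S.nM x y, S.nM (-x) (S.conj y), h1, mul_eq_one_comm.1 h1⟩, ?_⟩, rfl⟩
  show (S.nM x y).transpose * S.betaM * (S.nM x y).map S.conj = S.betaM
  ext i j
  fin_cases i <;> fin_cases j <;>
    simp [nM, betaM, Matrix.mul_apply, Fin.sum_univ_three, S.conj_invol]
  linear_combination h

end Matrices

section Unipotent

variable {S}

lemma betaE_conj_mem_N'k {k : ℤ} {g : S.GG} (hg : g ∈ S.Nk k) :
    S.betaE * g * S.betaE ∈ S.N'k k := by
  obtain ⟨x, y, h, hy, hm⟩ := hg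
  refine ⟨-S.conj x, y, ?_, hy, ?_⟩
  · rw [map_neg, S.conj_invol]; linear_combination h
  · ext i j
    rw [mat_betaE_conj, hm]
    fin_cases i <;> fin_cases j <;> simp [nM, n'M, Fin.rev, S.conj_invol]

lemma betaE_conj_mem_Nk {k : ℤ} {g : S.GG} (hg : g ∈ S.N'k k) :
    S.betaE * g * S.betaE ∈ S.Nk k := by
  obtain ⟨x, y, h, hy, hm⟩ := hg
  refine ⟨-S.conj x, y, ?_, hy, ?_⟩
  · rw [map_neg, S.conj_invol]; linear_combination h
  · ext i j
    rw [mat_betaE_conj, hm]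
    fin_cases i <;> fin_cases j <;> simp [nM, n'M, Fin.rev, S.conj_invol]

lemma betaE_conj_conj (g : S.GG) : S.betaE * (S.betaE * g * S.betaE) * S.betaE = g := by
  rw [show S.betaE * (S.betaE * g * S.betaE) * S.betaE =
    (S.betaE * S.betaE) * g * (S.betaE * S.betaE) by group, betaE_mul_self]
  simp

lemma one_mem_Nk (k : ℤ) : (1 : S.GG) ∈ S.Nk k := by
  refine ⟨0, 0, by simp, zero_mem_pE k, ?_⟩
  rw [mat_one]
  ext i j
  fin_cases i <;> fin_cases j <;> simp [nM]

lemma mul_mem_Nk {k : ℤ} {g h : S.GG} (hg : g ∈ S.Nk k) (hh : h ∈ S.Nk k) : g * h ∈ S.Nk k := by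
  obtain ⟨x, y, e, hy, hm⟩ := hg
  obtain ⟨x', y', e', hy', hm'⟩ := hh
  refine ⟨x + x', y + y' - x * S.conj x', ?_, ?_, ?_⟩
  · simp only [map_add, map_sub, map_mul, S.conj_invol]
    linear_combination e + e'
  · rw [sub_eq_add_neg]
    exact add_mem_pE (add_mem_pE hy hy')
      (neg_mem_pE (mul_conj_mem_pE (norm_mem_pE e hy) (norm_mem_pE e' hy')))
  · rw [mat_mul, hm, hm']
    ext i j
    fin_cases i <;> fin_cases j <;> simp [nM, Matrix.mul_apply, Fin.sum_univ_three] <;> ring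

lemma inv_mem_Nk {k : ℤ} {g : S.GG} (hg : g ∈ S.Nk k) : g⁻¹ ∈ S.Nk k := by
  obtain ⟨x, y, e, hy, hm⟩ := hg
  have e' : -x * S.conj (-x) + S.conj y + S.conj (S.conj y) = 0 := by
    rw [map_neg, S.conj_invol]; linear_combination e
  obtain ⟨h, hh⟩ := exists_mat_eq_nM e'
  have : g * h = 1 := by
    apply mat_injective
    rw [mat_mul, hm, hh, mat_one]
    ext i j
    fin_cases i <;> fin_cases j <;> simp [nM, Matrix.mul_apply, Fin.sum_univ_three]
    linear_combination e
  rw [inv_eq_of_mul_eq_one_right this]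
  exact ⟨-x, S.conj y, e', conj_mem_pE hy, hh⟩

/-- `N_k` as a subgroup of `G`. -/
def NkSub (k : ℤ) : Subgroup S.GG where
  carrier := S.Nk k
  one_mem' := one_mem_Nk k
  mul_mem' := mul_mem_Nk
  inv_mem' := inv_mem_Nk

/-- `N'_k` as a subgroup of `G`. -/
def N'kSub (k : ℤ) : Subgroup S.GG where
  carrier := S.N'k k
  one_mem' := by
    have := betaE_conj_mem_N'k (one_mem_Nk (S := S) k)
    rwa [mul_one, betaE_mul_self] at this
  mul_mem' := by
    intro a b ha hb
    have := betaE_conj_mem_N'k (mul_mem_Nk (betaE_conj_mem_Nk ha) (betaE_conj_mem_Nk hb))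
    rwa [show S.betaE * a * S.betaE * (S.betaE * b * S.betaE) =
      S.betaE * (a * (S.betaE * S.betaE) * b) * S.betaE by group, betaE_mul_self, mul_one,
      betaE_conj_conj] at this
  inv_mem' := by
    intro a ha
    have := betaE_conj_mem_N'k (inv_mem_Nk (betaE_conj_mem_Nk ha))
    rwa [mul_inv_rev, mul_inv_rev, betaE_inv, ← mul_assoc S.betaE a⁻¹, betaE_conj_conj] at this

lemma Nk_anti {k l : ℤ} (h : k ≤ l) {g : S.GG} (hg : g ∈ S.Nk l) : g ∈ S.Nk k := by
  obtain ⟨x, y, e, hy, hm⟩ := hg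
  exact ⟨x, y, e, pE_mono h hy, hm⟩

lemma N'k_anti {k l : ℤ} (h : k ≤ l) {g : S.GG} (hg : g ∈ S.N'k l) : g ∈ S.N'k k := by
  obtain ⟨x, y, e, hy, hm⟩ := hg
  exact ⟨x, y, e, pE_mono h hy, hm⟩

lemma alphaE_conj_mem_Nk {k l : ℤ} (n : ℤ) (hl : l = k - 2 * n) {g : S.GG} (hg : g ∈ S.Nk k) :
    S.alphaE ^ n * g * S.alphaE ^ (-n) ∈ S.Nk l := by
  obtain ⟨x, y, e, hy, hm⟩ := hg
  have h2 : S.ϖ ^ (-(2 * n)) = S.ϖ ^ (-n) * S.ϖ ^ (-n) := by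
    rw [← zpow_add₀ S.unif_ne]; ring_nf
  have hc : ∀ m : ℤ, S.conj (S.ϖ ^ m) = S.ϖ ^ m := fun m => by rw [map_zpow₀, S.unif_conj]
  refine ⟨S.ϖ ^ (-n) * x, S.ϖ ^ (-(2 * n)) * y, ?_, ?_, ?_⟩
  · rw [map_mul, map_mul, hc, hc, h2]
    linear_combination (S.ϖ ^ (-n) * S.ϖ ^ (-n)) * e
  · rw [zpow_mul_mem_pE]
    convert hy using 2
    omega
  · ext i j
    rw [mat_alphaE_conj, hm]
    fin_cases i <;> fin_cases j <;> simp [nM, wt, map_zpow₀, S.unif_conj]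
    left
    ring_nf

end Unipotent

end Setting

namespace Setting

variable {S : Setting}

/-- A uniform description of the entries of `K₀` (for `j = 0`) and `K₁` (for `j = 1`). -/
def KEntries (j : ℤ) (g : S.GG) : Prop :=
  S.mat g 0 0 ∈ S.pE 0 ∧ S.mat g 0 1 ∈ S.pE 0 ∧ S.mat g 0 2 ∈ S.pE (-j) ∧
    S.mat g 1 0 ∈ S.pE j ∧ S.mat g 1 1 ∈ S.pE 0 ∧ S.mat g 1 2 ∈ S.pE 0 ∧
    S.mat g 2 0 ∈ S.pE j ∧ S.mat g 2 1 ∈ S.pE j ∧ S.mat g 2 2 ∈ S.pE 0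

/-- A uniform description of the further conditions cutting out the pro-p Iwahori subgroup
inside `K₀` (for `j = 0`) and `K₁` (for `j = 1`). -/
def IEntries (j : ℤ) (g : S.GG) : Prop :=
  S.mat g 1 0 ∈ S.pE 1 ∧ S.mat g 2 0 ∈ S.pE (1 + j) ∧ S.mat g 2 1 ∈ S.pE 1 ∧
    S.mat g 0 0 - 1 ∈ S.pE 1 ∧ S.mat g 1 1 - 1 ∈ S.pE 1 ∧ S.mat g 2 2 - 1 ∈ S.pE 1

lemma entries_of_mem_Nk {j : ℤ} (hj0 : 0 ≤ j) (hj1 : j ≤ 1) {g : S.GG} (hg : g ∈ S.Nk (-j)) :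
    KEntries j g ∧ IEntries j g := by
  obtain ⟨x, y, e, hy, hm⟩ := hg
  have hx : x ∈ S.pE 0 := mem_pE_of_norm_mem (norm_mem_pE e hy) (by omega)
  have hx' := neg_mem_pE (conj_mem_pE hx)
  have h1 : (1 : S.E) ∈ S.pE 0 := mem_pE_zero.2 S.O.one_mem
  have h0 := fun k => zero_mem_pE (S := S) k
  constructor
  · refine ⟨?_, ?_, ?_, ?_, ?_, ?_, ?_, ?_, ?_⟩ <;> rw [hm] <;> simp [nM, *]
  · refine ⟨?_, ?_, ?_, ?_, ?_, ?_⟩ <;> rw [hm] <;> simp [nM, h0]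

lemma entries_of_mem_N'k {j : ℤ} (hj0 : 0 ≤ j) (hj1 : j ≤ 1) {g : S.GG} (hg : g ∈ S.N'k (1 + j)) :
    KEntries j g ∧ IEntries j g := by
  obtain ⟨x, y, e, hy, hm⟩ := hg
  have hx : x ∈ S.pE 1 := mem_pE_of_norm_mem (norm_mem_pE e hy) (by omega)
  have hx' := neg_mem_pE (conj_mem_pE hx)
  have hxj := pE_mono hj1 hx
  have hxj' := pE_mono hj1 hx'
  have hyj : y ∈ S.pE j := pE_mono (by omega) hy
  have h1 : (1 : S.E) ∈ S.pE 0 := mem_pE_zero.2 S.O.one_mem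
  have h0 := fun k => zero_mem_pE (S := S) k
  constructor
  · refine ⟨?_, ?_, ?_, ?_, ?_, ?_, ?_, ?_, ?_⟩ <;> rw [hm] <;> simp [n'M, *]
  · refine ⟨?_, ?_, ?_, ?_, ?_, ?_⟩ <;> rw [hm] <;> simp [n'M, *]

lemma KEntries.two_zero {j : ℤ} {g : S.GG} (hg : KEntries j g) : S.mat g 2 0 ∈ S.pE j :=
  hg.2.2.2.2.2.2.1

lemma mem_Nk_of_alphaE_conj {j k n : ℤ} (hk : k ≤ 2 * n - j) {g : S.GG} {l : ℤ} (hg : g ∈ S.Nk l)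
    (h : KEntries j (S.alphaE ^ n * g * S.alphaE ^ (-n))) : g ∈ S.Nk k := by
  obtain ⟨x, y, e, -, hm⟩ := hg
  refine ⟨x, y, e, ?_, hm⟩
  have h2 := h.2.2.1
  rw [mat_alphaE_conj, hm, zpow_mul_mem_pE] at h2
  refine pE_mono ?_ (by simpa [nM] using h2)
  simp [wt]
  omega

lemma mem_N'k_of_alphaE_conj {j k n : ℤ} (hk : k ≤ 2 * n + j) {g : S.GG} {l : ℤ}
    (hg : g ∈ S.N'k l) (h : KEntries j (S.alphaE ^ (-n) * g * S.alphaE ^ (- -n))) :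
    g ∈ S.N'k k := by
  obtain ⟨x, y, e, -, hm⟩ := hg
  refine ⟨x, y, e, ?_, hm⟩
  have h2 := h.two_zero
  rw [mat_alphaE_conj, hm, zpow_mul_mem_pE] at h2
  refine pE_mono ?_ (by simpa [n'M] using h2)
  simp [wt]
  omega

lemma pE_zpow_mul {k m : ℤ} {x : S.E} (hm : 0 ≤ m) (hx : x ∈ S.pE k) : S.ϖ ^ m * x ∈ S.pE k :=
  zpow_mul_mem_pE.2 (pE_mono (by omega) hx)

/-- Right multiplication by an element of `N_{-j}` makes an element of the pro-p Iwahori subgroup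
lower triangular. -/
lemma exists_Nk_mul_lower {j : ℤ} (hj0 : 0 ≤ j) {g : S.GG} (hK : KEntries j g)
    (hI : IEntries j g) : ∃ u ∈ S.Nk (-j),
      S.mat (g * u) 0 1 = 0 ∧ S.mat (g * u) 0 2 = 0 ∧ S.mat (g * u) 1 2 = 0 := by
  have ha := hI.2.2.2.1
  have ha0 := ne_zero_of_sub_one_mem ha
  have hai := inv_mem_of_sub_one_mem ha
  set a := S.mat g 0 0 with hadef
  set b := S.mat g 0 1 with hbdef
  set c := S.mat g 0 2 with hcdef
  have hac0 : S.conj a ≠ 0 := (map_ne_zero S.conj).2 ha0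
  have hr : a * S.conj c + b * S.conj b + c * S.conj a = 0 := by
    simpa [betaM] using row_form g 0 0
  have e : (-(b * a⁻¹)) * S.conj (-(b * a⁻¹)) +
      (-(b * S.conj b * (a⁻¹ * S.conj a⁻¹) + c * a⁻¹)) +
      S.conj (-(b * S.conj b * (a⁻¹ * S.conj a⁻¹) + c * a⁻¹)) = 0 := by
    simp only [map_neg, map_add, map_mul, map_inv₀, S.conj_invol]
    field_simp
    linear_combination -hr
  obtain ⟨u, hu⟩ := exists_mat_eq_nM e
  have h01 : S.mat (g * u) 0 1 = 0 := by
    rw [mat_mul, hu]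
    simp [nM, Matrix.mul_apply, Fin.sum_univ_three, ← hadef, ← hbdef]
    field_simp
    ring
  have h02 : S.mat (g * u) 0 2 = 0 := by
    rw [mat_mul, hu]
    simp [nM, Matrix.mul_apply, Fin.sum_univ_three, ← hadef, ← hbdef, ← hcdef]
    field_simp
    ring
  have h00 : S.mat (g * u) 0 0 = a := by
    rw [mat_mul, hu]
    simp [nM, Matrix.mul_apply, Fin.sum_univ_three, ← hadef]
  refine ⟨u, ⟨_, _, e, ?_, hu⟩, h01, h02, ?_⟩
  · have hb := hK.2.1
    have h1 := mul_mem_pE (mul_mem_pE hb (conj_mem_pE hb)) (mul_mem_pE hai (conj_mem_pE hai))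
    have h2 := mul_mem_pE hK.2.2.1 hai
    rw [add_zero] at h2
    exact neg_mem_pE (add_mem_pE (pE_mono (by omega) h1) h2)
  · have h := row_form (g * u) 0 1
    rw [h01, h02, h00] at h
    simpa [betaM, ha0] using h

/-- Right multiplication by an element of `N'_{1+j}` makes an element of the pro-p Iwahori subgroup
upper triangular. -/
lemma exists_N'k_mul_upper {j : ℤ} (hj1 : j ≤ 1) {g : S.GG}
    (hI : IEntries j g) : ∃ u ∈ S.N'k (1 + j),
      S.mat (g * u) 1 0 = 0 ∧ S.mat (g * u) 2 0 = 0 ∧ S.mat (g * u) 2 1 = 0 := by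
  have hc := hI.2.2.2.2.2
  have hc0 := ne_zero_of_sub_one_mem hc
  have hci := inv_mem_of_sub_one_mem hc
  set a := S.mat g 2 0 with hadef
  set b := S.mat g 2 1 with hbdef
  set c := S.mat g 2 2 with hcdef
  have hcc0 : S.conj c ≠ 0 := (map_ne_zero S.conj).2 hc0
  have hr : a * S.conj c + b * S.conj b + c * S.conj a = 0 := by
    simpa [betaM] using row_form g 2 2
  have e : (S.conj b * S.conj c⁻¹) * S.conj (S.conj b * S.conj c⁻¹) +
      (-(b * S.conj b * (c⁻¹ * S.conj c⁻¹) + a * c⁻¹)) +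
      S.conj (-(b * S.conj b * (c⁻¹ * S.conj c⁻¹) + a * c⁻¹)) = 0 := by
    simp only [map_neg, map_add, map_mul, map_inv₀, S.conj_invol]
    field_simp
    linear_combination -hr
  obtain ⟨u', hu'⟩ := exists_mat_eq_nM (S := S) (x := -S.conj (S.conj b * S.conj c⁻¹))
    (y := -(b * S.conj b * (c⁻¹ * S.conj c⁻¹) + a * c⁻¹)) (by
    rw [map_neg, S.conj_invol]; linear_combination e)
  obtain ⟨u, hu⟩ : ∃ u : S.GG, S.mat u = S.n'M (S.conj b * S.conj c⁻¹)
      (-(b * S.conj b * (c⁻¹ * S.conj c⁻¹) + a * c⁻¹)) := by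
    refine ⟨S.betaE * u' * S.betaE, ?_⟩
    ext i j
    rw [mat_betaE_conj, hu']
    fin_cases i <;> fin_cases j <;> simp [nM, n'M, Fin.rev, S.conj_invol]
  have h21 : S.mat (g * u) 2 1 = 0 := by
    rw [mat_mul, hu]
    simp [n'M, Matrix.mul_apply, Fin.sum_univ_three, ← hcdef, ← hbdef, S.conj_invol]
    field_simp
    ring
  have h20 : S.mat (g * u) 2 0 = 0 := by
    rw [mat_mul, hu]
    simp [n'M, Matrix.mul_apply, Fin.sum_univ_three, ← hadef, ← hbdef, ← hcdef]
    field_simp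
    ring
  have h22 : S.mat (g * u) 2 2 = c := by
    rw [mat_mul, hu]
    simp [n'M, Matrix.mul_apply, Fin.sum_univ_three, ← hcdef]
  refine ⟨u, ⟨_, _, e, ?_, hu⟩, ?_, h20, h21⟩
  · have hb := hI.2.2.1
    have h1 := mul_mem_pE (mul_mem_pE hb (conj_mem_pE hb)) (mul_mem_pE hci (conj_mem_pE hci))
    have h2 := mul_mem_pE hI.2.1 hci
    rw [add_zero] at h2
    exact neg_mem_pE (add_mem_pE (pE_mono (by omega) h1) h2)
  · have h := row_form (g * u) 2 1
    rw [h20, h21, h22] at h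
    simpa [betaM, hc0] using h

lemma KEntries.alphaE_conj_lower {j n : ℤ} (hn : 0 ≤ n) {g : S.GG} (hg : KEntries j g)
    (h : S.mat g 0 1 = 0 ∧ S.mat g 0 2 = 0 ∧ S.mat g 1 2 = 0) :
    KEntries j (S.alphaE ^ n * g * S.alphaE ^ (-n)) := by
  obtain ⟨h00, h01, h02, h10, h11, h12, h20, h21, h22⟩ := hg
  refine ⟨?_, ?_, ?_, ?_, ?_, ?_, ?_, ?_, ?_⟩ <;> rw [mat_alphaE_conj]
  case refine_2 | refine_3 | refine_6 => simp [h, zero_mem_pE]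
  all_goals exact pE_zpow_mul (by simp [wt]; try omega) (by assumption)

lemma KEntries.alphaE_conj_upper {j n : ℤ} (hn : 0 ≤ n) {g : S.GG} (hg : KEntries j g)
    (h : S.mat g 1 0 = 0 ∧ S.mat g 2 0 = 0 ∧ S.mat g 2 1 = 0) :
    KEntries j (S.alphaE ^ (-n) * g * S.alphaE ^ (- -n)) := by
  obtain ⟨h00, h01, h02, h10, h11, h12, h20, h21, h22⟩ := hg
  refine ⟨?_, ?_, ?_, ?_, ?_, ?_, ?_, ?_, ?_⟩ <;> rw [mat_alphaE_conj]
  case refine_4 | refine_7 | refine_8 => simp [h, zero_mem_pE]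
  all_goals exact pE_zpow_mul (by simp [wt]; try omega) (by assumption)

end Setting

open Setting

namespace Chamber

variable {S : Setting} (C : Chamber S)

/-- Both chambers are described uniformly by a parameter `j ∈ {0, 1}`. -/
lemma exists_uniform : ∃ j : ℤ, 0 ≤ j ∧ j ≤ 1 ∧ C.nK = -j ∧ C.mK = 1 + j ∧
    C.βK = S.betaE * S.alphaE ^ (-j) ∧ (∀ g, g ∈ C.K ↔ KEntries j g) ∧
    ∀ g, g ∈ C.I1 ↔ KEntries j g ∧ IEntries j g := by
  rcases C.cases with ⟨hK, -, -, hI, -, hβ, hn, hm, -⟩ | ⟨hK, -, -, hI, -, hβ, hn, hm, -⟩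
  · have hK' : ∀ g : S.GG, g ∈ S.K0set ↔ KEntries 0 g := by
      intro g
      simp only [K0set, Set.mem_ofPred_eq, Fin.forall_fin_succ, KEntries, ← mem_pE_zero, neg_zero]
      simp [and_assoc]
    refine ⟨0, le_rfl, zero_le_one, by rw [hn]; rfl, by rw [hm]; rfl, by rw [hβ]; simp, ?_, ?_⟩
    · intro g
      rw [← SetLike.mem_coe, hK, hK']
    · intro g
      rw [hI]
      show (g ∈ S.K0set ∧ _) ∧ _ ↔ _
      rw [hK', and_assoc]
      simp only [IEntries, add_zero, and_assoc]
  · have hK' : ∀ g : S.GG, g ∈ S.K1set ↔ KEntries 1 g := by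
      intro g
      simp only [K1set, Set.mem_ofPred_eq, KEntries, mem_pE_zero]
    refine ⟨1, zero_le_one, le_rfl, by rw [hn], by rw [hm]; rfl, by rw [hβ, zpow_neg_one]; rfl,
      ?_, ?_⟩
    · intro g
      rw [← SetLike.mem_coe, hK, hK']
    · intro g
      rw [hI]
      show (g ∈ S.K1set ∧ _) ∧ _ ↔ _
      rw [hK']
      simp only [IEntries, KEntries]
      norm_num
      tauto

end Chamber

/-- Summing the right translates of a left-equivariant function supported on `K a B` over
representatives of `A / B` gives the function supported on `K a A` with the same value at `a`. -/
lemma sum_translates_eq {S : Setting} {C : Chamber S} {𝔽 : Type} [Field 𝔽] {W : Type}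
    [AddCommGroup W] [Module 𝔽 W] {σ : Representation 𝔽 ↥C.K W} {F₁ F₂ : S.GG → W}
    {A B : Subgroup S.GG} {a : S.GG} {v : W} {U : Finset S.GG}
    (hU : S.IsReps A B U) (hBA : B ≤ A)
    (h₁K : ∀ (k : S.GG) (hk : k ∈ C.K) (g : S.GG), F₁ (k * g) = σ ⟨k, hk⟩ (F₁ g))
    (h₂K : ∀ (k : S.GG) (hk : k ∈ C.K) (g : S.GG), F₂ (k * g) = σ ⟨k, hk⟩ (F₂ g))
    (h₁B : ∀ b ∈ B, ∀ g, F₁ (g * b) = F₁ g) (h₂A : ∀ b ∈ A, ∀ g, F₂ (g * b) = F₂ g)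
    (h₁s : ∀ x, F₁ x ≠ 0 → ∃ k ∈ C.K, ∃ b ∈ B, x = k * a * b)
    (h₂s : ∀ x, F₂ x ≠ 0 → ∃ k ∈ C.K, ∃ b ∈ A, x = k * a * b)
    (h₁a : F₁ a = v) (h₂a : F₂ a = v)
    (hsep : ∀ g ∈ A, a * g * a⁻¹ ∈ C.K → g ∈ B) (x : S.GG) :
    ∑ u ∈ U, F₁ (x * u) = F₂ x := by
  by_cases hx : ∃ k ∈ C.K, ∃ b ∈ A, x = k * a * b
  · obtain ⟨k, hk, b, hb, rfl⟩ := hx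
    rw [h₂A b hb, h₂K k hk, h₂a]
    obtain ⟨u, ⟨huU, hu⟩, huniq⟩ := hU.2 b⁻¹ (A.inv_mem hb)
    rw [inv_inv] at hu
    rw [Finset.sum_eq_single_of_mem u huU, mul_assoc, h₁B _ hu, h₁K k hk, h₁a]
    intro w hw hne
    by_contra h0
    apply hne
    apply huniq
    refine ⟨hw, ?_⟩
    rw [inv_inv]
    obtain ⟨k', hk', b', hb', e⟩ := h₁s _ h0
    have hm : b * w * b'⁻¹ ∈ B := by
      refine hsep _ (A.mul_mem (A.mul_mem hb (hU.1 hw)) (A.inv_mem (hBA hb'))) ?_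
      have : a * (b * w * b'⁻¹) * a⁻¹ = k⁻¹ * k' := by
        have e' : a * (b * w) = k⁻¹ * (k' * a * b') := by rw [← e]; group
        calc _ = (a * (b * w)) * b'⁻¹ * a⁻¹ := by group
          _ = _ := by rw [e']; group
      rw [this]
      exact C.K.mul_mem (C.K.inv_mem hk) hk'
    simpa using B.mul_mem hm hb'
  · have h2 : F₂ x = 0 := by
      by_contra h0
      exact hx (h₂s x h0)
    rw [h2]
    refine Finset.sum_eq_zero fun u hu => ?_
    by_contra h0
    obtain ⟨k, hk, b, hb, e⟩ := h₁s _ h0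
    exact hx ⟨k, hk, b * u⁻¹, A.mul_mem (hBA hb) (A.inv_mem (hU.1 hu)), by
      rw [← mul_assoc, ← e]; group⟩

section Weyl

variable {S : Setting}

lemma alphaE_zpow_mul_weyl (n i : ℤ) :
    S.alphaE ^ n * (S.betaE * S.alphaE ^ (-i)) = (S.betaE * S.alphaE ^ (-i)) * S.alphaE ^ (-n) := by
  rw [← mul_assoc, alphaE_zpow_mul_betaE, mul_assoc, mul_assoc, ← zpow_add, ← zpow_add, add_comm]

lemma weyl_eq (i : ℤ) : S.betaE * S.alphaE ^ (-i) = S.alphaE ^ i * S.betaE :=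
  (alphaE_zpow_mul_betaE i).symm

lemma weyl_mul_self (i : ℤ) : (S.betaE * S.alphaE ^ (-i)) * (S.betaE * S.alphaE ^ (-i)) = 1 := by
  nth_rewrite 2 [weyl_eq]
  rw [show S.betaE * S.alphaE ^ (-i) * (S.alphaE ^ i * S.betaE) = S.betaE * S.betaE by group,
    betaE_mul_self]

lemma weyl_conj_mem_N'k {k l i : ℤ} (hl : l = k + 2 * i) {g : S.GG} (hg : g ∈ S.Nk k) :
    (S.betaE * S.alphaE ^ (-i)) * g * (S.betaE * S.alphaE ^ (-i)) ∈ S.N'k l := by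
  have := betaE_conj_mem_N'k (alphaE_conj_mem_Nk (l := l) (-i) (by omega) hg)
  nth_rewrite 2 [weyl_eq]
  rw [neg_neg] at this
  simpa only [mul_assoc] using this

lemma weyl_conj_mem_Nk {k l i : ℤ} (hl : l = k - 2 * i) {g : S.GG} (hg : g ∈ S.N'k k) :
    (S.betaE * S.alphaE ^ (-i)) * g * (S.betaE * S.alphaE ^ (-i)) ∈ S.Nk l := by
  have := alphaE_conj_mem_Nk (l := l) i hl (betaE_conj_mem_Nk hg)
  nth_rewrite 1 [weyl_eq]
  simpa only [mul_assoc] using this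

lemma weyl_entries (j : ℤ) : KEntries j (S.betaE * S.alphaE ^ (-j)) := by
  have h1 : (1 : S.E) ∈ S.pE 0 := mem_pE_zero.2 S.O.one_mem
  refine ⟨?_, ?_, ?_, ?_, ?_, ?_, ?_, ?_, ?_⟩ <;> rw [mat_mul, mat_betaE, mat_alphaE_zpow] <;>
    simp [betaM, Matrix.mul_apply, Fin.sum_univ_three, zero_mem_pE, h1]
  · simpa using zpow_mem_pE (S := S) (-j)
  · exact zpow_mem_pE j

end Weyl

/-- For `n ≥ 1`, `S_K(f_n) = f_{-n}`; for `n ≥ 0`, `S_-(f_{-n}) = f_{n+1}`. -/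
theorem stmt17
    (S : Setting) (C : Chamber S)
    (𝔽 : Type) [Field 𝔽] [IsAlgClosed 𝔽] [Algebra (ZMod S.p) 𝔽]
    [Algebra.IsAlgebraic (ZMod S.p) 𝔽]
    (W : Type) [AddCommGroup W] [Module 𝔽 W]
    (σ : Representation 𝔽 ↥C.K W) (hσ : IsWeight C 𝔽 W σ)
    (v0 : W) (ff : ℤ → ↥(IndSub C 𝔽 W σ)) (hff : IsFFamily C 𝔽 W σ v0 ff) :
    (∀ n : ℤ, 1 ≤ n → ∀ U : Finset S.GG, S.IsReps (S.Nk C.nK) (S.Nk (C.nK + 1)) U →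
      ∑ u ∈ U, indRep C 𝔽 W σ (u * C.βK) (ff n) = ff (-n)) ∧
    (∀ n : ℤ, 0 ≤ n → ∀ U' : Finset S.GG, S.IsReps (S.N'k C.mK) (S.N'k (C.mK + 1)) U' →
      ∑ u ∈ U', indRep C 𝔽 W σ (u * C.βK * S.alphaE⁻¹) (ff (-n)) = ff (n + 1)) := by
  obtain ⟨j, hj0, hj1, hn, hm, hβ, hK, hI⟩ := C.exists_uniform
  obtain ⟨-, hv, hinv, hsupp, hpos, hneg⟩ := hff
  have hequiv : ∀ (m : ℤ) (k : S.GG) (hk : k ∈ C.K) (g : S.GG),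
      (ff m : S.GG → W) (k * g) = σ ⟨k, hk⟩ ((ff m : S.GG → W) g) := fun m => (ff m).2.1
  have hright : ∀ (m : ℤ), ∀ i ∈ C.I1, ∀ x, (ff m : S.GG → W) (x * i) = (ff m : S.GG → W) x :=
    fun m i hi x => congrFun (congrArg Subtype.val (hinv m i hi)) x
  have hβK : C.βK ∈ C.K := by rw [hK, hβ]; exact weyl_entries j
  have hN : ∀ g ∈ S.Nk (-j), g ∈ C.I1 := fun g hg => (hI g).2 (entries_of_mem_Nk hj0 hj1 hg)
  have hN' : ∀ g ∈ S.N'k (1 + j), g ∈ C.I1 := fun g hg => (hI g).2 (entries_of_mem_N'k hj0 hj1 hg)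
  have hs_pos : ∀ m : ℤ, 0 ≤ m → ∀ x, (ff m : S.GG → W) x ≠ 0 →
      ∃ k ∈ C.K, ∃ u ∈ S.N'k (1 + j), x = k * S.alphaE ^ (-m) * u := by
    intro m hm0 x hx
    obtain ⟨k, hk, i, hi, rfl⟩ := hsupp m x hx
    obtain ⟨u, hu, h0⟩ := exists_N'k_mul_upper hj1 ((hI i).1 hi).2
    have hiu : KEntries j (i * u) := (hK _).1 <| C.K.mul_mem ((hK i).2 ((hI i).1 hi).1)
      ((hK u).2 (entries_of_mem_N'k hj0 hj1 hu).1)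
    exact ⟨_, C.K.mul_mem hk ((hK _).2 (hiu.alphaE_conj_upper hm0 h0)), u⁻¹,
      (N'kSub (1 + j)).inv_mem hu, by group⟩
  have hs_neg : ∀ m : ℤ, 0 ≤ m → ∀ x, (ff (-m) : S.GG → W) x ≠ 0 →
      ∃ k ∈ C.K, ∃ u ∈ S.Nk (-j), x = k * S.alphaE ^ m * u := by
    intro m hm0 x hx
    obtain ⟨k, hk, i, hi, rfl⟩ := hsupp (-m) x hx
    obtain ⟨u, hu, h0⟩ := exists_Nk_mul_lower hj0 ((hI i).1 hi).1 ((hI i).1 hi).2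
    have hiu : KEntries j (i * u) := (hK _).1 <| C.K.mul_mem ((hK i).2 ((hI i).1 hi).1)
      ((hK u).2 (entries_of_mem_Nk hj0 hj1 hu).1)
    exact ⟨_, C.K.mul_mem hk ((hK _).2 (hiu.alphaE_conj_lower hm0 h0)), u⁻¹,
      (NkSub (-j)).inv_mem hu, by group⟩
  have hββ : C.βK * C.βK = 1 := by rw [hβ]; exact weyl_mul_self j
  have hβα : ∀ m : ℤ, S.alphaE ^ m * C.βK = C.βK * S.alphaE ^ (-m) := fun m => by
    rw [hβ]; exact alphaE_zpow_mul_weyl m j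
  have hσβ : σ ⟨C.βK, hβK⟩ (σ ⟨C.βK, hβK⟩ v0) = v0 := by
    rw [← Module.End.mul_apply, ← map_mul,
      show (⟨C.βK, hβK⟩ : ↥C.K) * ⟨C.βK, hβK⟩ = 1 from Subtype.ext hββ, map_one,
      Module.End.one_apply]
  have hσ' : sigma' C 𝔽 W σ C.βK v0 = σ ⟨C.βK, hβK⟩ v0 := by
    simp [sigma', hβK]
  constructor
  · intro n hn1 U hU
    apply Subtype.ext
    funext x
    rw [AddSubmonoidClass.coe_finsetSum, Finset.sum_apply]
    rw [hn] at hU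
    have hconj : ∀ b, C.βK * (C.βK * b) = b := fun b => by rw [← mul_assoc, hββ, one_mul]
    have key := sum_translates_eq (C := C) (σ := σ)
      (F₁ := fun x => (ff n : S.GG → W) (x * C.βK)) (F₂ := (ff (-n) : S.GG → W))
      (A := NkSub (-j)) (B := NkSub (-j + 1)) (a := S.alphaE ^ n) (v := v0) (U := U) hU
      (fun g hg => Nk_anti (by omega) hg) ?_ (hequiv _) ?_ (fun b hb => hright _ b (hN b hb))
      ?_ (hs_neg n (by omega)) ?_ ?_ ?_ x
    · rw [← key]
      exact Finset.sum_congr rfl fun u _ => congrArg (ff n : S.GG → W) (mul_assoc x u C.βK).symm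
    · intro k hk g
      simp only [mul_assoc]
      exact hequiv n k hk _
    · intro b hb g
      have hb' : C.βK * b * C.βK ∈ S.N'k (1 + j) := by
        rw [hβ]; exact weyl_conj_mem_N'k (by omega) hb
      have := hright n _ (hN' _ hb') (g * C.βK)
      simpa only [mul_assoc, hconj] using this
    · intro y hy
      obtain ⟨k, hk, u, hu, e⟩ := hs_pos n (by omega) _ hy
      refine ⟨k * C.βK, C.K.mul_mem hk hβK, C.βK * u * C.βK, ?_, ?_⟩
      · show _ ∈ S.Nk _
        rw [hβ]; exact weyl_conj_mem_Nk (by omega) hu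
      · calc y = y * C.βK * C.βK := by rw [mul_assoc, hββ, mul_one]
          _ = k * (C.βK * C.βK) * S.alphaE ^ (-n) * u * C.βK := by rw [e, hββ, mul_one]
          _ = k * C.βK * (C.βK * S.alphaE ^ (-n)) * u * C.βK := by simp only [mul_assoc]
          _ = _ := by rw [← hβα]; simp only [mul_assoc]
    · show (ff n : S.GG → W) (S.alphaE ^ n * C.βK) = v0
      rw [hβα, hequiv n _ hβK, hpos n (by omega), hσ', hσβ]
    · simpa using hneg (-n) (by omega)
    · intro g hg h
      rw [hK, ← zpow_neg] at h
      exact mem_Nk_of_alphaE_conj (by omega) hg h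
  · intro n hn0 U hU
    apply Subtype.ext
    funext x
    rw [AddSubmonoidClass.coe_finsetSum, Finset.sum_apply]
    rw [hm] at hU
    set γ := C.βK * S.alphaE⁻¹ with hγdef
    have hγ : γ = S.betaE * S.alphaE ^ (-(j + 1)) := by
      rw [hγdef, hβ, mul_assoc, ← zpow_sub_one]
      congr 2
      ring
    have hγγ : γ * γ = 1 := by rw [hγ]; exact weyl_mul_self _
    have hconj : ∀ b, γ * (γ * b) = b := fun b => by rw [← mul_assoc, hγγ, one_mul]
    have hγα : S.alphaE ^ n * γ = C.βK * S.alphaE ^ (-(n + 1)) := by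
      rw [hγdef, ← mul_assoc, hβα]; group
    have key := sum_translates_eq (C := C) (σ := σ)
      (F₁ := fun x => (ff (-n) : S.GG → W) (x * γ)) (F₂ := (ff (n + 1) : S.GG → W))
      (A := N'kSub (1 + j)) (B := N'kSub (1 + j + 1)) (a := S.alphaE ^ (-(n + 1)))
      (v := σ ⟨C.βK, hβK⟩ v0) (U := U) hU
      (fun g hg => N'k_anti (by omega) hg) ?_ (hequiv _) ?_ (fun b hb => hright _ b (hN' b hb))
      ?_ (hs_pos (n + 1) (by omega)) ?_ ?_ ?_ x
    · rw [← key]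
      refine Finset.sum_congr rfl fun u _ => congrArg (ff (-n) : S.GG → W) ?_
      rw [hγdef]
      simp only [mul_assoc]
    · intro k hk g
      simp only [mul_assoc]
      exact hequiv (-n) k hk _
    · intro b hb g
      have hb' : γ * b * γ ∈ S.Nk (-j) := by
        rw [hγ]; exact weyl_conj_mem_Nk (by omega) hb
      have := hright (-n) _ (hN _ hb') (g * γ)
      simpa only [mul_assoc, hconj] using this
    · intro y hy
      obtain ⟨k, hk, u, hu, e⟩ := hs_neg n hn0 _ hy
      refine ⟨k * C.βK, C.K.mul_mem hk hβK, γ * u * γ, ?_, ?_⟩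
      · show _ ∈ S.N'k _
        rw [hγ]; exact weyl_conj_mem_N'k (by omega) hu
      · calc y = y * γ * γ := by rw [mul_assoc, hγγ, mul_one]
          _ = k * S.alphaE ^ n * (γ * γ) * u * γ := by rw [e, hγγ, mul_one]
          _ = k * (S.alphaE ^ n * γ) * (γ * u * γ) := by simp only [mul_assoc]
          _ = _ := by rw [hγα]; simp only [mul_assoc]
    · show (ff (-n) : S.GG → W) (S.alphaE ^ (-(n + 1)) * γ) = _
      have : S.alphaE ^ (-(n + 1)) * γ = C.βK * S.alphaE ^ (- -n) := by
        rw [hγdef, ← mul_assoc, hβα]; group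
      rw [this, hequiv (-n) _ hβK, hneg (-n) (by omega)]
    · rw [hpos (n + 1) (by omega), hσ']
    · intro g hg h
      rw [hK, ← zpow_neg] at h
      exact mem_N'k_of_alphaE_conj (by omega) hg h

end U21
end
end

section
/- For all x, y in E with x*xbar + y + ybar = 0 and y ≠ 0, the following matrix identity holds in G: beta * n(x,y) = n(ybar^{-1}*x, y^{-1}) * h(ybar^{-1}) * n'(-ybar^{-1}*xbar, y^{-1}). (In particular the arguments of n, n' and h on the right-hand side satisfy the required conditions: ybar^{-1}x and y^{-1} satisfy the relation defining n, -ybar^{-1}xbar and y^{-1} satisfy the relation defining n', and ybar^{-1} in E^*.) -/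
open scoped Classical

noncomputable section

namespace U21

/-- The matrix identity
`β n(x,y) = n(ȳ⁻¹x, y⁻¹) h(ȳ⁻¹) n'(-ȳ⁻¹x̄, y⁻¹)` for `x x̄ + y + ȳ = 0`, `y ≠ 0`,
together with the admissibility of the arguments on the right-hand side. -/
theorem stmt19 (S : Setting) :
    ∀ x y : S.E, x * S.conj x + y + S.conj y = 0 → y ≠ 0 →
      S.betaM * S.nM x y =
        S.nM (S.conj y⁻¹ * x) y⁻¹ * S.hM (S.conj y⁻¹) *
          S.n'M (-(S.conj y⁻¹ * S.conj x)) y⁻¹ ∧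
      (S.conj y⁻¹ * x) * S.conj (S.conj y⁻¹ * x) + y⁻¹ + S.conj y⁻¹ = 0 ∧
      (-(S.conj y⁻¹ * S.conj x)) * S.conj (-(S.conj y⁻¹ * S.conj x)) + y⁻¹ + S.conj y⁻¹ = 0 ∧
      S.conj y⁻¹ ≠ 0 := by
  intro x y h hy
  have hy' : S.conj y ≠ 0 := (map_ne_zero S.conj).mpr hy
  refine ⟨?_, ?_, ?_, ?_⟩
  · ext i j
    fin_cases i <;> fin_cases j <;>
      simp [Setting.betaM, Setting.nM, Setting.hM, Setting.n'M, Matrix.mul_apply,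
        Fin.sum_univ_three, S.conj_invol] <;>
      field_simp
    · linear_combination -h
    · ring
    · ring
    · linear_combination h
  · simp only [map_mul, map_inv₀, S.conj_invol]
    field_simp
    linear_combination h
  · simp only [map_neg, map_mul, map_inv₀, S.conj_invol]
    field_simp
    linear_combination h
  · simpa using hy

end U21
end
end
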